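/- Define H(α, δ) = E{log[φ(u; α + Xβ + Zγ, W(γ)⁻¹) · φ(γ; δ, D)]}, where the expectation is over γ ~ N(0,D) and y ~ f(·|γ), u = u(y,γ) has components u_i = η_i(γ) + (y_i − b'(η_i(γ)))/b''(η_i(γ)), and W(γ) = diag(b''(η_1(γ)), …, b''(η_n(γ))). Then for all deterministic α ∈ ℝⁿ and δ ∈ ℝʳ, H(α, δ) = H(0, 0) − (1/2) Σ_{i=1}^n α_i² E[b''(η_i(γ))] − (1/2) δᵀ D⁻¹ δ, and consequently H(α, δ) ≤ H(0, 0) with equality if and only if α = 0 and δ = 0, provided E[b''(η_i(γ))] is finite and positive for each i and H(0,0) is finite. -/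

import Mathlib

open Matrix MeasureTheory

/-- The multivariate Gaussian probability density of `N(a, A)` evaluated at `t`. -/
noncomputable def gauss {ι : Type*} [Fintype ι] [DecidableEq ι]
    (t a : ι → ℝ) (A : Matrix ι ι ℝ) : ℝ :=
  (2 * Real.pi) ^ (-(Fintype.card ι : ℝ) / 2) * A.det ^ (-(1 : ℝ) / 2) *
    Real.exp (-(1 / 2) * ((t - a) ⬝ᵥ (A⁻¹ *ᵥ (t - a))))

lemma gauss_pos {ι : Type*} [Fintype ι] [DecidableEq ι] (t a : ι → ℝ) {A : Matrix ι ι ℝ}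
    (hA : 0 < A.det) : 0 < gauss t a A := by
  unfold gauss
  positivity

lemma log_gauss {ι : Type*} [Fintype ι] [DecidableEq ι] (t a : ι → ℝ) {A : Matrix ι ι ℝ}
    (hA : 0 < A.det) :
    Real.log (gauss t a A) =
      Real.log ((2 * Real.pi) ^ (-(Fintype.card ι : ℝ) / 2) * A.det ^ (-(1 : ℝ) / 2)) -
        1 / 2 * ((t - a) ⬝ᵥ (A⁻¹ *ᵥ (t - a))) := by
  unfold gauss
  rw [Real.log_mul (by positivity) (by positivity), Real.log_exp]
  ring

lemma continuous_gauss {ι : Type*} [Fintype ι] [DecidableEq ι] (a : ι → ℝ)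
    (A : Matrix ι ι ℝ) : Continuous fun t => gauss t a A := by
  unfold gauss
  fun_prop

open scoped MatrixOrder ComplexOrder in
lemma Matrix.PosDef.exists_eq_mul_transpose {ι : Type*} [Fintype ι] [DecidableEq ι]
    {A : Matrix ι ι ℝ} (hA : A.PosDef) : ∃ M : Matrix ι ι ℝ, A = M * Mᵀ ∧ M.det ≠ 0 := by
  obtain ⟨B, hB⟩ := CStarAlgebra.nonneg_iff_eq_star_mul_self.mp hA.posSemidef.nonneg
  refine ⟨Bᵀ, by simpa [star_eq_conjTranspose] using hB, fun h => hA.det_pos.ne' ?_⟩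
  rw [det_transpose] at h
  rw [hB, det_mul, h, mul_zero]

lemma gauss_mulVec {ι : Type*} [Fintype ι] [DecidableEq ι] (M : Matrix ι ι ℝ)
    (hM : M.det ≠ 0) (z : ι → ℝ) :
    gauss (M *ᵥ z) 0 (M * Mᵀ) =
      |M.det|⁻¹ * ∏ i, ((2 * Real.pi) ^ (-(1 : ℝ) / 2) * Real.exp (-(1 / 2) * z i ^ 2)) := by
  have hdet : (M * Mᵀ).det = |M.det| ^ 2 := by rw [det_mul, det_transpose, sq_abs, sq]
  have hpow : (|M.det| ^ 2) ^ (-(1 : ℝ) / 2) = |M.det|⁻¹ := by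
    rw [← Real.rpow_natCast, ← Real.rpow_mul (abs_nonneg _), ← Real.rpow_neg_one]
    norm_num
  have hu : IsUnit M.det := hM.isUnit
  have hquad : (M *ᵥ z) ⬝ᵥ ((M * Mᵀ)⁻¹ *ᵥ (M *ᵥ z)) = ∑ i, z i ^ 2 := by
    rw [mulVec_mulVec, Matrix.mul_inv_rev, Matrix.mul_assoc, nonsing_inv_mul _ hu,
      Matrix.mul_one, dotProduct_mulVec, ← mulVec_transpose, mulVec_mulVec,
      ← transpose_nonsing_inv, transpose_transpose, nonsing_inv_mul _ hu, one_mulVec]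
    simp [dotProduct, sq]
  have hconst : (2 * Real.pi) ^ (-(Fintype.card ι : ℝ) / 2) =
      ((2 * Real.pi) ^ (-(1 : ℝ) / 2)) ^ Fintype.card ι := by
    rw [← Real.rpow_natCast, ← Real.rpow_mul (by positivity)]
    ring_nf
  rw [gauss, sub_zero, hquad, hdet, hpow, hconst, Finset.prod_mul_distrib, Finset.prod_const,
    ← Real.exp_sum, ← Finset.mul_sum, Finset.card_univ]
  ring

lemma integrable_prod_mul_exp {ι : Type*} [Fintype ι] (K : ℝ) :
    Integrable fun z : ι → ℝ => ∏ i, (K * Real.exp (-(1 / 2) * z i ^ 2)) :=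
  Integrable.fintype_prod (f := fun _ x => K * Real.exp (-(1 / 2) * x ^ 2)) fun _ =>
    (integrable_exp_neg_mul_sq (by norm_num)).const_mul K

lemma integrable_apply_mul_prod_mul_exp {ι : Type*} [Fintype ι] [DecidableEq ι] (K : ℝ)
    (j : ι) :
    Integrable fun z : ι → ℝ => z j * ∏ i, (K * Real.exp (-(1 / 2) * z i ^ 2)) := by
  have h := Integrable.fintype_prod (μ := fun _ : ι => (volume : Measure ℝ))
    (f := fun i x => (if i = j then x else 1) * (K * Real.exp (-(1 / 2) * x ^ 2))) fun i => by
      split_ifs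
      · simpa only [mul_left_comm] using
          (integrable_mul_exp_neg_mul_sq (b := 1 / 2) (by norm_num)).const_mul K
      · simpa only [one_mul] using
          (integrable_exp_neg_mul_sq (b := 1 / 2) (by norm_num)).const_mul K
  refine h.congr (Filter.Eventually.of_forall fun z => ?_)
  dsimp only
  rw [Finset.prod_mul_distrib, Finset.prod_ite_eq' Finset.univ j z, if_pos (Finset.mem_univ j)]

lemma integrable_comp_mulVec_iff {ι : Type*} [Fintype ι] [DecidableEq ι] {M : Matrix ι ι ℝ}
    (hM : M.det ≠ 0) {g : (ι → ℝ) → ℝ} (hg : Continuous g) :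
    Integrable (fun z => g (M *ᵥ z)) ↔ Integrable g := by
  have hmap := Real.map_matrix_volume_pi_eq_smul_volume_pi hM
  have h := integrable_map_measure (μ := (volume : Measure (ι → ℝ))) (f := toLin' M)
    hg.aestronglyMeasurable (LinearMap.continuous_of_finiteDimensional _).aemeasurable
  rw [hmap, integrable_smul_measure (by simpa using hM) ENNReal.ofReal_ne_top] at h
  exact h.symm

lemma integral_comp_mulVec {ι : Type*} [Fintype ι] [DecidableEq ι] {M : Matrix ι ι ℝ}
    (hM : M.det ≠ 0) {g : (ι → ℝ) → ℝ} (hg : Continuous g) :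
    ∫ z, g (M *ᵥ z) = |M.det|⁻¹ * ∫ t, g t := by
  have hmap := Real.map_matrix_volume_pi_eq_smul_volume_pi hM
  have h := integral_map (μ := (volume : Measure (ι → ℝ))) (φ := toLin' M)
    (LinearMap.continuous_of_finiteDimensional _).aemeasurable hg.aestronglyMeasurable
  rw [hmap, integral_smul_measure, ENNReal.toReal_ofReal (abs_nonneg _), abs_inv] at h
  exact h.symm

lemma integrable_gauss {ι : Type*} [Fintype ι] [DecidableEq ι] {A : Matrix ι ι ℝ}
    (hA : A.PosDef) : Integrable fun t : ι → ℝ => gauss t 0 A := by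
  obtain ⟨M, rfl, hM⟩ := hA.exists_eq_mul_transpose
  rw [← integrable_comp_mulVec_iff hM (continuous_gauss _ _)]
  simp_rw [gauss_mulVec M hM]
  exact (integrable_prod_mul_exp _).const_mul _

lemma integral_gauss {ι : Type*} [Fintype ι] [DecidableEq ι] {A : Matrix ι ι ℝ}
    (hA : A.PosDef) : ∫ t : ι → ℝ, gauss t 0 A = 1 := by
  obtain ⟨M, rfl, hM⟩ := hA.exists_eq_mul_transpose
  have h := integral_comp_mulVec hM (continuous_gauss 0 (M * Mᵀ))
  have hone : ∫ x : ℝ, (2 * Real.pi) ^ (-(1 : ℝ) / 2) * Real.exp (-(1 / 2) * x ^ 2) = 1 := by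
    rw [integral_const_mul, integral_gaussian, Real.sqrt_eq_rpow,
      show Real.pi / (1 / 2) = 2 * Real.pi by ring, ← Real.rpow_add (by positivity)]
    norm_num
  simp_rw [gauss_mulVec M hM] at h
  rw [integral_const_mul, integral_fintype_prod_volume_eq_pow
    (fun x : ℝ => (2 * Real.pi) ^ (-(1 : ℝ) / 2) * Real.exp (-(1 / 2) * x ^ 2)), hone,
    one_pow] at h
  exact (mul_left_cancel₀ (inv_ne_zero (abs_ne_zero.mpr hM)) h).symm

lemma integrable_dotProduct_mul_gauss {ι : Type*} [Fintype ι] [DecidableEq ι]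
    {A : Matrix ι ι ℝ} (hA : A.PosDef) (v : ι → ℝ) :
    Integrable fun t : ι → ℝ => (v ⬝ᵥ t) * gauss t 0 A := by
  obtain ⟨M, rfl, hM⟩ := hA.exists_eq_mul_transpose
  rw [← integrable_comp_mulVec_iff hM (by have := continuous_gauss 0 (M * Mᵀ); fun_prop)]
  simp_rw [gauss_mulVec M hM, dotProduct_mulVec, dotProduct, Finset.sum_mul]
  refine integrable_finsetSum _ fun j _ => ?_
  refine ((integrable_apply_mul_prod_mul_exp ((2 * Real.pi) ^ (-(1 : ℝ) / 2)) j).const_mul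
    ((v ᵥ* M) j * |M.det|⁻¹)).congr (Filter.Eventually.of_forall fun z => ?_)
  dsimp only
  ring

lemma integral_dotProduct_mul_gauss {ι : Type*} [Fintype ι] [DecidableEq ι]
    (A : Matrix ι ι ℝ) (v : ι → ℝ) :
    ∫ t : ι → ℝ, (v ⬝ᵥ t) * gauss t 0 A = 0 := by
  have h := integral_neg_eq_self (fun t : ι → ℝ => (v ⬝ᵥ t) * gauss t 0 A) volume
  have hneg : ∀ t : ι → ℝ, (v ⬝ᵥ -t) * gauss (-t) 0 A = -((v ⬝ᵥ t) * gauss t 0 A) := by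
    intro t
    simp [gauss, mulVec_neg]
  simp_rw [hneg, integral_neg] at h
  linarith

lemma log_gauss_diagonal_inv_sub {ι : Type*} [Fintype ι] [DecidableEq ι] {w : ι → ℝ}
    (hw : ∀ i, 0 < w i) (m s α : ι → ℝ) :
    Real.log (gauss (fun i => m i + s i / w i) (α + m) (diagonal w)⁻¹) =
      Real.log ((2 * Real.pi) ^ (-(Fintype.card ι : ℝ) / 2) *
        ((diagonal w)⁻¹).det ^ (-(1 : ℝ) / 2)) - 1 / 2 * ∑ i, s i ^ 2 / w i +
        ∑ i, α i * s i - 1 / 2 * ∑ i, α i ^ 2 * w i := by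
  have hdet : 0 < (diagonal w).det := by
    rw [det_diagonal]
    exact Finset.prod_pos fun i _ => hw i
  have hdet' : 0 < ((diagonal w)⁻¹).det := by
    rw [det_nonsing_inv, Ring.inverse_eq_inv']
    positivity
  rw [log_gauss _ _ hdet', nonsing_inv_nonsing_inv _ hdet.ne'.isUnit]
  simp only [dotProduct, mulVec_diagonal, Pi.sub_apply, Pi.add_apply]
  have hterm : ∀ i, (m i + s i / w i - (α i + m i)) * (w i * (m i + s i / w i - (α i + m i))) =
      s i ^ 2 / w i - 2 * (α i * s i) + α i ^ 2 * w i := by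
    intro i
    have := (hw i).ne'
    field_simp
    ring
  simp_rw [hterm, Finset.sum_add_distrib, Finset.sum_sub_distrib, ← Finset.mul_sum]
  ring

lemma log_gauss_mean_eq {ι : Type*} [Fintype ι] [DecidableEq ι] {A : Matrix ι ι ℝ}
    (hA : A.PosDef) (t a : ι → ℝ) :
    Real.log (gauss t a A) = Real.log (gauss t 0 A) + (A⁻¹ *ᵥ a) ⬝ᵥ t -
      1 / 2 * (a ⬝ᵥ (A⁻¹ *ᵥ a)) := by
  have hsymm : (A⁻¹)ᵀ = A⁻¹ := by simpa using hA.inv.isHermitian.eq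
  have hswap : a ⬝ᵥ (A⁻¹ *ᵥ t) = (A⁻¹ *ᵥ a) ⬝ᵥ t := by
    rw [dotProduct_mulVec, ← mulVec_transpose, hsymm]
  rw [log_gauss _ _ hA.det_pos, log_gauss _ _ hA.det_pos, sub_zero, mulVec_sub, sub_dotProduct,
    dotProduct_sub, dotProduct_sub, hswap, dotProduct_comm t (A⁻¹ *ᵥ a)]
  ring

lemma integrable_mul_of_integrable_sum_sq {ι Ω : Type*} [Fintype ι] [MeasurableSpace Ω]
    {μ : Measure Ω} {g : Ω → ℝ} (hg : Integrable g μ) (hg0 : ∀ x, 0 ≤ g x) {w : ι → ℝ}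
    (hw : ∀ i, 0 < w i) {s : ι → Ω → ℝ} (hs : ∀ i, Measurable (s i))
    (hsq : Integrable (fun x => (∑ i, s i x ^ 2 / w i) * g x) μ) (i : ι) :
    Integrable (fun x => s i x * g x) μ := by
  refine (hsq.add (hg.const_mul (w i))).mono'
    ((hs i).aestronglyMeasurable.mul hg.aestronglyMeasurable)
    (Filter.Eventually.of_forall fun x => ?_)
  have hle : s i x ^ 2 / w i ≤ ∑ j, s j x ^ 2 / w j :=
    Finset.single_le_sum (f := fun j => s j x ^ 2 / w j)
      (fun j _ => div_nonneg (sq_nonneg _) (hw j).le) (Finset.mem_univ i)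
  have hamgm : |s i x| ≤ s i x ^ 2 / w i + w i := by
    have hi := hw i
    rw [← sub_le_iff_le_add, le_div_iff₀ hi, ← sq_abs]
    nlinarith [sq_nonneg (|s i x| - w i), mul_nonneg (abs_nonneg (s i x)) hi.le]
  rw [norm_mul, Real.norm_eq_abs, Real.norm_of_nonneg (hg0 x), Pi.add_apply, ← add_mul]
  exact mul_le_mul_of_nonneg_right (by linarith) (hg0 x)

/-- For the working LMM objective
`H(α, δ) = E log[φ(u; α + Xβ + Zγ, W(γ)⁻¹) φ(γ; δ, D)]` one has
`H(α, δ) = H(0,0) − ½ Σᵢ αᵢ² E[b''(ηᵢ(γ))] − ½ δᵀ D⁻¹ δ`, hence `H(α, δ) ≤ H(0, 0)`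
with equality iff `α = 0` and `δ = 0` (Lemma 2 of the paper). -/
theorem stmt_13 (n p r : ℕ) (hn : 0 < n) (hp : 0 < p) (hr : 0 < r)
    (X : Matrix (Fin n) (Fin p) ℝ) (Z : Matrix (Fin n) (Fin r) ℝ)
    (β : Fin p → ℝ) (D : Matrix (Fin r) (Fin r) ℝ) (hD : D.PosDef)
    (η : (Fin r → ℝ) → Fin n → ℝ) (hη : ∀ γ, η γ = X *ᵥ β + Z *ᵥ γ)
    (b : ℝ → ℝ) (hb : ContDiff ℝ 2 b) (hb'' : ∀ t, 0 < deriv (deriv b) t)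
    (ν : Measure (Fin n → ℝ)) [SigmaFinite ν] (c : ℝ → ℝ)
    (f : (Fin n → ℝ) → (Fin r → ℝ) → ℝ)
    (hf : ∀ y γ, f y γ =
      Real.exp (y ⬝ᵥ η γ - ∑ i, b (η γ i) + ∑ i, c (y i)))
    (hfprob : ∀ γ, ∫ y, f y γ ∂ν = 1)
    (hfint : ∀ γ, Integrable (fun y => f y γ) ν)
    (hfmean : ∀ γ i, ∫ y, y i * f y γ ∂ν = deriv b (η γ i))
    -- the working response and the working weight matrix:
    (u : (Fin n → ℝ) → (Fin r → ℝ) → Fin n → ℝ)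
    (hu : ∀ y γ i, u y γ i =
      η γ i + (y i - deriv b (η γ i)) / deriv (deriv b) (η γ i))
    (W : (Fin r → ℝ) → Matrix (Fin n) (Fin n) ℝ)
    (hW : ∀ γ, W γ = Matrix.diagonal fun i => deriv (deriv b) (η γ i))
    (H : (Fin n → ℝ) → (Fin r → ℝ) → ℝ)
    (hH : ∀ α δ, H α δ = ∫ γ,
      (∫ y, Real.log (gauss (u y γ) (α + X *ᵥ β + Z *ᵥ γ) (W γ)⁻¹ * gauss γ δ D) *
        f y γ ∂ν) * gauss γ 0 D)
    -- `E[b''(ηᵢ(γ))]` is finite and positive for each `i`: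
    (hEb_int : ∀ i, Integrable (fun γ : Fin r → ℝ =>
      deriv (deriv b) (η γ i) * gauss γ 0 D))
    (hEb_pos : ∀ i, 0 < ∫ γ, deriv (deriv b) (η γ i) * gauss γ 0 D)
    -- `H(0, 0)` is finite:
    (hfin_inner : ∀ γ, Integrable (fun y =>
      Real.log (gauss (u y γ) ((0 : Fin n → ℝ) + X *ᵥ β + Z *ᵥ γ) (W γ)⁻¹ *
        gauss γ (0 : Fin r → ℝ) D) * f y γ) ν)
    (hfin_outer : Integrable (fun γ : Fin r → ℝ =>
      (∫ y, Real.log (gauss (u y γ) ((0 : Fin n → ℝ) + X *ᵥ β + Z *ᵥ γ) (W γ)⁻¹ *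
        gauss γ (0 : Fin r → ℝ) D) * f y γ ∂ν) * gauss γ 0 D)) :
    ∀ (α : Fin n → ℝ) (δ : Fin r → ℝ),
      (H α δ = H 0 0 -
          (1 / 2) * ∑ i, (α i) ^ 2 * (∫ γ, deriv (deriv b) (η γ i) * gauss γ 0 D) -
          (1 / 2) * (δ ⬝ᵥ (D⁻¹ *ᵥ δ))) ∧
      H α δ ≤ H 0 0 ∧ (H α δ = H 0 0 ↔ α = 0 ∧ δ = 0) := by
  have hlog : ∀ α δ y γ,
      Real.log (gauss (u y γ) (α + X *ᵥ β + Z *ᵥ γ) (W γ)⁻¹ * gauss γ δ D) =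
        Real.log ((2 * Real.pi) ^ (-(Fintype.card (Fin n) : ℝ) / 2) *
          (W γ)⁻¹.det ^ (-(1 : ℝ) / 2)) + Real.log (gauss γ 0 D) -
        1 / 2 * ∑ i, (y i - deriv b (η γ i)) ^ 2 / deriv (deriv b) (η γ i) +
        ∑ i, α i * (y i - deriv b (η γ i)) -
        1 / 2 * ∑ i, α i ^ 2 * deriv (deriv b) (η γ i) +
        (D⁻¹ *ᵥ δ) ⬝ᵥ γ - 1 / 2 * (δ ⬝ᵥ (D⁻¹ *ᵥ δ)) := by
    intro α δ y γ
    have hdet : 0 < ((W γ)⁻¹).det := by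
      rw [hW, det_nonsing_inv, Ring.inverse_eq_inv', det_diagonal]
      exact inv_pos.mpr (Finset.prod_pos fun i _ => hb'' _)
    rw [Real.log_mul (gauss_pos _ _ hdet).ne' (gauss_pos _ _ hD.det_pos).ne', add_assoc, ← hη,
      show u y γ = _ from funext (hu y γ), hW,
      log_gauss_diagonal_inv_sub (fun i => hb'' _) (η γ) (fun i => y i - deriv b (η γ i)),
      log_gauss_mean_eq hD γ δ]
    ring
  have hlog_diff : ∀ α δ y γ,
      Real.log (gauss (u y γ) (α + X *ᵥ β + Z *ᵥ γ) (W γ)⁻¹ * gauss γ δ D) =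
        Real.log (gauss (u y γ) ((0 : Fin n → ℝ) + X *ᵥ β + Z *ᵥ γ) (W γ)⁻¹ *
          gauss γ (0 : Fin r → ℝ) D) +
        ∑ i, α i * (y i - deriv b (η γ i)) +
        (-(1 / 2) * ∑ i, α i ^ 2 * deriv (deriv b) (η γ i) +
          (D⁻¹ *ᵥ δ) ⬝ᵥ γ - 1 / 2 * (δ ⬝ᵥ (D⁻¹ *ᵥ δ))) := by
    intro α δ y γ
    rw [hlog α δ, hlog 0 0]
    simp
    ring
  have hscore_int : ∀ γ i, Integrable (fun y => (y i - deriv b (η γ i)) * f y γ) ν := by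
    intro γ
    refine integrable_mul_of_integrable_sum_sq (w := fun i => deriv (deriv b) (η γ i))
      (s := fun i y => y i - deriv b (η γ i)) (hfint γ)
      (fun y => by rw [hf]; exact (Real.exp_pos _).le) (fun i => hb'' _)
      (fun i => by fun_prop) ?_
    refine (((hfint γ).const_mul (2 * (Real.log ((2 * Real.pi) ^ (-(Fintype.card (Fin n) : ℝ) / 2) *
      (W γ)⁻¹.det ^ (-(1 : ℝ) / 2)) + Real.log (gauss γ 0 D)))).sub
      ((hfin_inner γ).const_mul 2)).congr (Filter.Eventually.of_forall fun y => ?_)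
    simp only [Pi.sub_apply]
    rw [hlog 0 0]
    simp
    ring
  have hscore : ∀ γ i, ∫ y, (y i - deriv b (η γ i)) * f y γ ∂ν = 0 := by
    intro γ i
    have hsplit : ∀ y : Fin n → ℝ, y i * f y γ =
        (y i - deriv b (η γ i)) * f y γ + deriv b (η γ i) * f y γ := fun y => by ring
    have h := hfmean γ i
    simp_rw [hsplit] at h
    rw [integral_add (hscore_int γ i) ((hfint γ).const_mul _), integral_const_mul, hfprob] at h
    linarith
  have hinner : ∀ α δ γ,
      ∫ y, Real.log (gauss (u y γ) (α + X *ᵥ β + Z *ᵥ γ) (W γ)⁻¹ * gauss γ δ D) * f y γ ∂ν =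
        ∫ y, Real.log (gauss (u y γ) ((0 : Fin n → ℝ) + X *ᵥ β + Z *ᵥ γ) (W γ)⁻¹ *
          gauss γ (0 : Fin r → ℝ) D) * f y γ ∂ν +
        (-(1 / 2) * ∑ i, α i ^ 2 * deriv (deriv b) (η γ i) +
          (D⁻¹ *ᵥ δ) ⬝ᵥ γ - 1 / 2 * (δ ⬝ᵥ (D⁻¹ *ᵥ δ))) := by
    intro α δ γ
    have hlin : Integrable
        (fun y => ∑ i, α i * ((y i - deriv b (η γ i)) * f y γ)) ν :=
      integrable_finsetSum _ fun i _ => (hscore_int γ i).const_mul _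
    have hlin0 : ∫ y, ∑ i, α i * ((y i - deriv b (η γ i)) * f y γ) ∂ν = 0 := by
      rw [integral_finsetSum _ fun i _ => (hscore_int γ i).const_mul _]
      simp [integral_const_mul, hscore]
    simp_rw [hlog_diff α δ, add_mul _ _ (f _ γ), Finset.sum_mul, mul_assoc (α _)]
    rw [integral_add ((hfin_inner γ).fun_add hlin) ((hfint γ).const_mul _),
      integral_add (hfin_inner γ) hlin, hlin0, integral_const_mul, hfprob]
    ring
  intro α δ
  have hformula : H α δ = H 0 0 -
      (1 / 2) * ∑ i, (α i) ^ 2 * (∫ γ, deriv (deriv b) (η γ i) * gauss γ 0 D) -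
      (1 / 2) * (δ ⬝ᵥ (D⁻¹ *ᵥ δ)) := by
    have hsum : Integrable (fun γ : Fin r → ℝ =>
        ∑ i, α i ^ 2 * (deriv (deriv b) (η γ i) * gauss γ 0 D)) :=
      integrable_finsetSum _ fun i _ => (hEb_int i).const_mul _
    have hexpand : ∀ γ, (∫ y, Real.log (gauss (u y γ) (α + X *ᵥ β + Z *ᵥ γ) (W γ)⁻¹ *
        gauss γ δ D) * f y γ ∂ν) * gauss γ 0 D =
        (((∫ y, Real.log (gauss (u y γ) ((0 : Fin n → ℝ) + X *ᵥ β + Z *ᵥ γ) (W γ)⁻¹ *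
          gauss γ (0 : Fin r → ℝ) D) * f y γ ∂ν) * gauss γ 0 D -
        1 / 2 * ∑ i, α i ^ 2 * (deriv (deriv b) (η γ i) * gauss γ 0 D)) +
        ((D⁻¹ *ᵥ δ) ⬝ᵥ γ) * gauss γ 0 D) - 1 / 2 * (δ ⬝ᵥ (D⁻¹ *ᵥ δ)) * gauss γ 0 D := by
      intro γ
      rw [hinner α δ]
      simp_rw [← mul_assoc, ← Finset.sum_mul]
      ring
    rw [hH α δ, hH 0 0]
    simp_rw [hexpand]
    rw [integral_sub ((hfin_outer.sub' (hsum.const_mul _)).fun_add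
        (integrable_dotProduct_mul_gauss hD _)) ((integrable_gauss hD).const_mul _),
      integral_add (hfin_outer.sub' (hsum.const_mul _)) (integrable_dotProduct_mul_gauss hD _),
      integral_sub hfin_outer (hsum.const_mul _), integral_dotProduct_mul_gauss,
      integral_const_mul, integral_const_mul, integral_gauss hD,
      integral_finsetSum _ fun i _ => (hEb_int i).const_mul _]
    simp_rw [integral_const_mul]
    ring
  have hα_nonneg : ∀ i ∈ Finset.univ,
      0 ≤ (α i) ^ 2 * ∫ γ, deriv (deriv b) (η γ i) * gauss γ 0 D :=
    fun i _ => mul_nonneg (sq_nonneg _) (hEb_pos i).le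
  have hα_sum := Finset.sum_nonneg hα_nonneg
  have hδ_nonneg : 0 ≤ δ ⬝ᵥ (D⁻¹ *ᵥ δ) := by
    simpa using hD.inv.posSemidef.dotProduct_mulVec_nonneg δ
  refine ⟨hformula, by linarith, fun heq => ?_, ?_⟩
  · have hα_zero : ∑ i, (α i) ^ 2 * (∫ γ, deriv (deriv b) (η γ i) * gauss γ 0 D) = 0 := by
      linarith
    refine ⟨funext fun i => ?_, ?_⟩
    · have hi := (Finset.sum_eq_zero_iff_of_nonneg hα_nonneg).mp hα_zero i (Finset.mem_univ i)
      simpa [(hEb_pos i).ne'] using hi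
    · by_contra hne
      have hpos : 0 < δ ⬝ᵥ (D⁻¹ *ᵥ δ) := by simpa using hD.inv.dotProduct_mulVec_pos hne
      linarith
  · rintro ⟨rfl, rfl⟩
    rfl
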